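/- arXiv:2007.15342 — 2 statements merged into one kernel-verified Lean document; each statement's English description precedes it below -/
import Mathlib

section
/- For every integer n ≥ 3, every tree t on n vertices and every linear arrangement π, the score Ω(t,π) satisfies Ω(t,π) ≥ −5. -/
open Finset

/-- Sum of dependency distances of graph `t` under the linear arrangement `π`:
vertices in consecutive positions are at distance 1. -/
noncomputable def cost {n : ℕ} (t : SimpleGraph (Fin n)) (π : Equiv.Perm (Fin n)) : ℕ :=
  letI := Classical.decRel t.Adj
  ∑ e ∈ t.edgeFinset,
    Sym2.lift ⟨fun u v => (((π u : ℕ) : ℤ) - ((π v : ℕ) : ℤ)).natAbs,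
      fun u v => by dsimp only; omega⟩ e

/-- Minimum of `cost t` over all linear arrangements. -/
noncomputable def Dmin {n : ℕ} (t : SimpleGraph (Fin n)) : ℕ :=
  Finset.univ.inf' Finset.univ_nonempty (cost t)

/-- Expected cost under a uniformly random linear arrangement: `(n² - 1)/3`. -/
noncomputable def Drla (n : ℕ) : ℚ := ((n : ℚ) ^ 2 - 1) / 3

/-- The optimality score `Ω`. -/
noncomputable def Omega {n : ℕ} (t : SimpleGraph (Fin n)) (π : Equiv.Perm (Fin n)) : ℚ :=
  (Drla n - (cost t π : ℚ)) / (Drla n - (Dmin t : ℚ))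

open Classical in
/-- Twice the cost of the edges inside `S` under the positions `f`. -/
noncomputable def costW {V : Type*} (G : SimpleGraph V) (S : Finset V) (f : V → ℤ) : ℤ :=
  ∑ u ∈ S, ∑ v ∈ S, if G.Adj u v then |f u - f v| else 0

/-- `f` places the vertices of `S` bijectively on `0, …, |S| - 1`. -/
def GoodPos {V : Type*} (S : Finset V) (f : V → ℤ) : Prop :=
  (∀ x ∈ S, ∀ y ∈ S, f x = f y → x = y) ∧ ∀ x ∈ S, 0 ≤ f x ∧ f x < (S.card : ℤ)

lemma GoodPos.image {V : Type*} {S : Finset V} {f : V → ℤ} (h : GoodPos S f) :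
    S.image f = Finset.Ico (0 : ℤ) S.card := by
  apply Finset.eq_of_subset_of_card_le
  · intro y hy
    rw [Finset.mem_image] at hy
    obtain ⟨x, hx, rfl⟩ := hy
    simpa using h.2 x hx
  · rw [Finset.card_image_of_injOn (fun x hx y hy hxy => h.1 x hx y hy hxy)]
    simp

lemma Ico_eq_image_range (n : ℕ) :
    Finset.Ico (0 : ℤ) n = (Finset.range n).image (fun i : ℕ => (i : ℤ)) := by
  ext y
  simp only [Finset.mem_Ico, Finset.mem_image, Finset.mem_range]
  constructor
  · rintro ⟨h0, h1⟩
    exact ⟨y.toNat, by omega, by omega⟩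
  · rintro ⟨a, ha, rfl⟩
    omega

lemma GoodPos.sum {V : Type*} {S : Finset V} {f : V → ℤ} (h : GoodPos S f) (g : ℤ → ℤ) :
    ∑ x ∈ S, g (f x) = ∑ i ∈ Finset.range S.card, g (i : ℤ) := by
  rw [← Finset.sum_image (f := g) (fun x hx y hy hxy => h.1 x hx y hy hxy), h.image,
    Ico_eq_image_range, Finset.sum_image]
  intro x _ y _ hxy
  simpa using hxy

lemma exists_goodPos {V : Type*} (S : Finset V) : ∃ f, GoodPos S f := by
  classical
  refine ⟨fun x => if h : x ∈ S then ((S.equivFin ⟨x, h⟩ : ℕ) : ℤ) else 0, ?_, ?_⟩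
  · intro x hx y hy hxy
    simp only [hx, hy, dif_pos, Nat.cast_inj] at hxy
    have := S.equivFin.injective (Fin.ext hxy)
    simpa using this
  · intro x hx
    simp only [hx, dif_pos]
    have := (S.equivFin ⟨x, hx⟩).2
    omega

lemma exists_goodPos_at {V : Type*} (S : Finset V) (c : V) (hc : c ∈ S) (k : ℕ) (hk : k < S.card) :
    ∃ f, GoodPos S f ∧ f c = k := by
  classical
  obtain ⟨g, hg⟩ := exists_goodPos S
  have : (k : ℤ) ∈ S.image g := by rw [hg.image]; simp [hk]
  rw [Finset.mem_image] at this
  obtain ⟨x, hx, hxk⟩ := this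
  have hm : ∀ y ∈ S, Equiv.swap c x y ∈ S := by
    intro y hy
    rw [Equiv.swap_apply_def]
    split_ifs <;> assumption
  refine ⟨fun y => g (Equiv.swap c x y), ⟨?_, ?_⟩, ?_⟩
  · intro a ha b hb hab
    exact (Equiv.swap c x).injective (hg.1 _ (hm a ha) _ (hm b hb) hab)
  · intro a ha
    exact hg.2 _ (hm a ha)
  · simp [hxk]

lemma sum_star_le (n : ℕ) : 4 * ∑ i ∈ Finset.range n, |(i : ℤ) - ((n / 2 : ℕ) : ℤ)| ≤ (n : ℤ) ^ 2 := by
  induction n using Nat.twoStepInduction with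
  | zero => simp
  | one => simp
  | more n ih _ =>
    rw [Finset.sum_range_succ, Finset.sum_range_succ']
    have h1 : (n + 2) / 2 = n / 2 + 1 := by omega
    have h2 : ∀ i : ℕ, |((i + 1 : ℕ) : ℤ) - ((n / 2 + 1 : ℕ) : ℤ)| = |(i : ℤ) - ((n / 2 : ℕ) : ℤ)| := by
      intro i; push_cast; congr 1; ring
    simp only [h1, h2]
    have h3 : |((0 : ℕ) : ℤ) - ((n / 2 + 1 : ℕ) : ℤ)| = ((n / 2 : ℕ) : ℤ) + 1 := by
      rw [abs_of_nonpos] <;> omega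
    have h4 : |(n : ℤ) - ((n / 2 : ℕ) : ℤ)| = n - ((n / 2 : ℕ) : ℤ) := by
      rw [abs_of_nonneg] <;> omega
    rw [h3, h4]
    push_cast at ih ⊢
    nlinarith

lemma sum_max_le (n : ℕ) :
    4 * ∑ i ∈ Finset.range n, max (i : ℤ) ((n : ℤ) - 1 - i) ≤ 3 * (n : ℤ) ^ 2 - 2 * n := by
  induction n using Nat.twoStepInduction with
  | zero => simp
  | one => simp
  | more n ih _ =>
    rw [Finset.sum_range_succ, Finset.sum_range_succ']
    have h2 : ∀ i : ℕ, max ((i + 1 : ℕ) : ℤ) (((n + 2 : ℕ) : ℤ) - 1 - ((i + 1 : ℕ) : ℤ))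
        = max (i : ℤ) ((n : ℤ) - 1 - i) + 1 := by
      intro i; omega
    simp only [h2, Finset.sum_add_distrib]
    have h3 : max ((0 : ℕ) : ℤ) (((n + 2 : ℕ) : ℤ) - 1 - ((0 : ℕ) : ℤ)) = n + 1 := by omega
    have h4 : max (n : ℤ) ((n : ℤ) - 1 - (n : ℤ)) = n := by omega
    rw [h3, h4]
    simp only [Finset.sum_const, Finset.card_range, nsmul_eq_mul, mul_one]
    push_cast at ih ⊢
    nlinarith

lemma costW_congr {V : Type*} (G : SimpleGraph V) (S : Finset V) (f g : V → ℤ)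
    (h : ∀ x ∈ S, ∀ y ∈ S, |f x - f y| = |g x - g y|) : costW G S f = costW G S g := by
  unfold costW
  refine Finset.sum_congr rfl fun x hx => Finset.sum_congr rfl fun y hy => ?_
  rw [h x hx y hy]

/-- Mirror an arrangement. -/
lemma GoodPos.mirror {V : Type*} {S : Finset V} {f : V → ℤ} (h : GoodPos S f) :
    GoodPos S (fun x => S.card - 1 - f x) := by
  refine ⟨fun x hx y hy hxy => h.1 x hx y hy (by simpa using hxy), fun x hx => ?_⟩
  have := h.2 x hx
  simp only
  omega

lemma costW_mirror {V : Type*} (G : SimpleGraph V) (S : Finset V) (f : V → ℤ) :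
    costW G S (fun x => S.card - 1 - f x) = costW G S f := by
  apply costW_congr
  intro x _ y _
  rw [abs_sub_comm (f x)]
  congr 1
  ring

/-- Concatenation of arrangements of disjoint sets. -/
lemma concat {V : Type*} [DecidableEq V] (G : SimpleGraph V) (A B : Finset V) (hAB : Disjoint A B)
    (f g : V → ℤ) (hf : GoodPos A f) (hg : GoodPos B g) (C : ℤ)
    (hC : ∀ F : V → ℤ, (∀ x ∈ A, F x = f x) → (∀ x ∈ B, F x = A.card + g x) →
      (open Classical in ∑ u ∈ A, ∑ v ∈ B, if G.Adj u v then |F u - F v| else 0) ≤ C) :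
    ∃ F, GoodPos (A ∪ B) F ∧ costW G (A ∪ B) F ≤ costW G A f + costW G B g + 2 * C := by
  classical
  set F : V → ℤ := fun x => if x ∈ A then f x else A.card + g x with hF
  have hFA : ∀ x ∈ A, F x = f x := fun x hx => by simp [hF, hx]
  have hFB : ∀ x ∈ B, F x = A.card + g x := fun x hx => by
    have : x ∉ A := fun h => (Finset.disjoint_left.mp hAB) h hx
    simp [hF, this]
  refine ⟨F, ⟨?_, ?_⟩, ?_⟩
  · intro x hx y hy hxy
    rw [Finset.mem_union] at hx hy
    rcases hx with hx | hx <;> rcases hy with hy | hy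
    · rw [hFA x hx, hFA y hy] at hxy; exact hf.1 x hx y hy hxy
    · rw [hFA x hx, hFB y hy] at hxy
      have := hf.2 x hx; have := hg.2 y hy; omega
    · rw [hFB x hx, hFA y hy] at hxy
      have := hg.2 x hx; have := hf.2 y hy; omega
    · rw [hFB x hx, hFB y hy] at hxy; exact hg.1 x hx y hy (by omega)
  · intro x hx
    rw [Finset.card_union_of_disjoint hAB]
    rw [Finset.mem_union] at hx
    rcases hx with hx | hx
    · rw [hFA x hx]; have := hf.2 x hx; omega
    · rw [hFB x hx]; have := hg.2 x hx; omega
  · have h1 : costW G A f = costW G A F := by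
      apply costW_congr
      intro x hx y hy
      rw [hFA x hx, hFA y hy]
    have h2 : costW G B g = costW G B F := by
      apply costW_congr
      intro x hx y hy
      rw [hFB x hx, hFB y hy]
      congr 1; ring
    have h3 := hC F hFA hFB
    have h4 : (∑ u ∈ B, ∑ v ∈ A, if G.Adj u v then |F u - F v| else 0)
        = ∑ u ∈ A, ∑ v ∈ B, if G.Adj u v then |F u - F v| else 0 := by
      rw [Finset.sum_comm]
      refine Finset.sum_congr rfl fun x hx => Finset.sum_congr rfl fun y hy => ?_
      rw [G.adj_comm, abs_sub_comm]
    rw [h1, h2]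
    unfold costW
    simp only [Finset.sum_union hAB, Finset.sum_add_distrib]
    rw [h4]
    linarith

lemma exists_arrangement {V : Type*} [DecidableEq V] (G : SimpleGraph V) (hG : G.IsAcyclic)
    (S : Finset V) : ∃ f, GoodPos S f ∧ 2 * costW G S f ≤ (S.card : ℤ) ^ 2 := by
  classical
  induction S using Finset.strongInduction with
  | H S ih =>
  by_cases hempty : S = ∅
  · subst hempty
    exact ⟨fun _ => 0, by simp [GoodPos], by simp [costW]⟩
  have hne : S.Nonempty := Finset.nonempty_iff_ne_empty.mpr hempty
  by_cases hE : ∃ u ∈ S, ∃ v ∈ S, G.Adj u v ∧ (∃ u' ∈ S, u' ≠ v ∧ G.Adj u u') ∧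
      (∃ v' ∈ S, v' ≠ u ∧ G.Adj v v')
  · obtain ⟨u, hu, v, hv, huv, ⟨u', hu', hu'v, huu'⟩, ⟨v', hv', hv'u, hvv'⟩⟩ := hE
    have hbr := SimpleGraph.isAcyclic_iff_forall_adj_isBridge.mp hG huv
    rw [SimpleGraph.isBridge_iff] at hbr
    set H := G.deleteEdges {s(u, v)} with hH
    set A := S.filter (fun x => H.Reachable u x) with hA
    set B := S.filter (fun x => ¬ H.Reachable u x) with hB
    have hAB : Disjoint A B := Finset.disjoint_filter_filter_not _ _ _
    have hU : A ∪ B = S := Finset.filter_union_filter_not_eq _ _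
    have huA : u ∈ A := by simp [hA, hu]
    have hvB : v ∈ B := by simp [hB, hv, hbr]
    have hu'A : u' ∈ A := by
      simp only [hA, Finset.mem_filter, hu', true_and]
      apply SimpleGraph.Adj.reachable
      rw [hH, SimpleGraph.deleteEdges_adj]
      refine ⟨huu', ?_⟩
      simp [hu'v, huv.ne]
    have hv'B : v' ∈ B := by
      simp only [hB, Finset.mem_filter, hv', true_and]
      intro hr
      apply hbr
      refine hr.trans (SimpleGraph.Adj.reachable ?_)
      rw [hH, SimpleGraph.deleteEdges_adj]
      refine ⟨hvv'.symm, ?_⟩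
      simp [hv'u, huv.ne']
    have hcross : ∀ x ∈ A, ∀ y ∈ B, G.Adj x y → x = u ∧ y = v := by
      intro x hx y hy hxy
      by_contra hcon
      have hy' := (Finset.mem_filter.mp hy).2
      apply hy'
      refine (Finset.mem_filter.mp hx).2.trans (SimpleGraph.Adj.reachable ?_)
      rw [hH, SimpleGraph.deleteEdges_adj]
      refine ⟨hxy, ?_⟩
      simp only [Set.mem_singleton_iff, Sym2.eq_iff, not_or]
      refine ⟨hcon, ?_⟩
      rintro ⟨rfl, rfl⟩
      exact Finset.disjoint_left.mp hAB huA hy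
    have hA2 : 2 ≤ A.card := by
      have : ({u, u'} : Finset V) ⊆ A := by
        intro x hx; simp at hx; rcases hx with rfl | rfl <;> assumption
      have h := Finset.card_le_card this
      rwa [Finset.card_pair huu'.ne] at h
    have hB2 : 2 ≤ B.card := by
      have : ({v, v'} : Finset V) ⊆ B := by
        intro x hx; simp at hx; rcases hx with rfl | rfl <;> assumption
      have h := Finset.card_le_card this
      rwa [Finset.card_pair hvv'.ne] at h
    have hcard : A.card + B.card = S.card := by
      rw [← hU, Finset.card_union_of_disjoint hAB]
    have hAS : A ⊂ S := by
      refine Finset.ssubset_iff_subset_ne.mpr ⟨Finset.filter_subset _ _, fun h => ?_⟩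
      rw [h] at hcard; omega
    have hBS : B ⊂ S := by
      refine Finset.ssubset_iff_subset_ne.mpr ⟨Finset.filter_subset _ _, fun h => ?_⟩
      rw [h] at hcard; omega
    obtain ⟨f, hf, hfc⟩ : ∃ f, (GoodPos A f ∧ 2 * costW G A f ≤ (A.card : ℤ) ^ 2) ∧
        (A.card : ℤ) - 1 ≤ 2 * f u := by
      obtain ⟨f, hf, hfc⟩ := ih A hAS
      by_cases h : (A.card : ℤ) - 1 ≤ 2 * f u
      · exact ⟨f, ⟨hf, hfc⟩, h⟩
      · exact ⟨_, ⟨hf.mirror, by rwa [costW_mirror]⟩, by omega⟩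
    obtain ⟨g, hg, hgc⟩ : ∃ g, (GoodPos B g ∧ 2 * costW G B g ≤ (B.card : ℤ) ^ 2) ∧
        2 * g v ≤ (B.card : ℤ) - 1 := by
      obtain ⟨f, hf, hfc⟩ := ih B hBS
      by_cases h : 2 * f v ≤ (B.card : ℤ) - 1
      · exact ⟨f, ⟨hf, hfc⟩, h⟩
      · exact ⟨_, ⟨hf.mirror, by rwa [costW_mirror]⟩, by omega⟩
    obtain ⟨F, hF, hFc⟩ := concat G A B hAB f g hf.1 hg.1 (A.card + g v - f u) (by
      intro F hFA hFB
      rw [Finset.sum_eq_single_of_mem u huA, Finset.sum_eq_single_of_mem v hvB]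
      · rw [if_pos huv, hFA u huA, hFB v hvB, abs_of_nonpos] 
        · linarith
        · have := hf.1.2 u huA; have := hg.1.2 v hvB; omega
      · intro y hy hyv
        rw [if_neg]
        exact fun h => hyv (hcross u huA y hy h).2
      · intro x hx hxu
        apply Finset.sum_eq_zero
        intro y hy
        rw [if_neg]
        exact fun h => hxu (hcross x hx y hy h).1)
    rw [hU] at hF hFc
    refine ⟨F, hF, ?_⟩
    rw [← hcard]
    have h2 := hf.2
    have h3 := hg.2
    have ha : (2 : ℤ) ≤ A.card := by exact_mod_cast hA2
    have hb : (2 : ℤ) ≤ B.card := by exact_mod_cast hB2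
    push_cast
    nlinarith [mul_nonneg (sub_nonneg.mpr ha) (sub_nonneg.mpr hb)]
  · -- every edge has an endpoint of degree one
    push Not at hE
    obtain ⟨c, hc, hmax⟩ := Finset.exists_max_image S (fun c => (S.filter (G.Adj c)).card) hne
    set A := S.filter (fun x => x = c ∨ G.Adj c x) with hA
    set B := S.filter (fun x => ¬ (x = c ∨ G.Adj c x)) with hB
    have hAB : Disjoint A B := Finset.disjoint_filter_filter_not _ _ _
    have hU : A ∪ B = S := Finset.filter_union_filter_not_eq _ _
    have hcA : c ∈ A := by simp [hA, hc]
    have hcard : A.card + B.card = S.card := by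
      rw [← hU, Finset.card_union_of_disjoint hAB]
    -- a neighbour of `c` has no other neighbour
    have hnb : ∀ w ∈ S, G.Adj c w → ∀ x ∈ S, G.Adj w x → x = c := by
      intro w hw hcw x hx hwx
      by_contra hxc
      have h1 : 2 ≤ (S.filter (G.Adj w)).card := by
        have : ({c, x} : Finset V) ⊆ S.filter (G.Adj w) := by
          intro y hy; simp at hy
          rcases hy with rfl | rfl
          · simp [hc, hcw.symm]
          · simp [hx, hwx]
        have h := Finset.card_le_card this
        rwa [Finset.card_pair (Ne.symm hxc)] at h
      have h2 := hmax w hw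
      have h3 : 1 < (S.filter (G.Adj c)).card := by omega
      obtain ⟨y, hy, hyw⟩ := Finset.exists_mem_ne h3 w
      rw [Finset.mem_filter] at hy
      exact hE c hc w hw hcw ⟨y, hy.1, hyw, hy.2⟩ x hx hxc hwx
    by_cases hBe : B = ∅
    · have hSA : ∀ x ∈ S, x = c ∨ G.Adj c x := by
        intro x hx
        by_contra hcon
        have : x ∈ B := Finset.mem_filter.mpr ⟨hx, hcon⟩
        rw [hBe] at this
        simp at this
      obtain ⟨f, hf, hfc⟩ := exists_goodPos_at S c hc (S.card / 2)
        (by have := Finset.card_pos.mpr hne; omega)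
      refine ⟨f, hf, ?_⟩
      have hle : costW G S f ≤ ∑ u ∈ S, ∑ v ∈ S, ((if u = c then |f v - f c| else 0) +
          (if v = c then |f u - f c| else 0)) := by
        unfold costW
        refine Finset.sum_le_sum fun x hx => Finset.sum_le_sum fun y hy => ?_
        have p1 := abs_nonneg (f x - f c)
        have p2 := abs_nonneg (f y - f c)
        by_cases hxy : G.Adj x y
        · rcases hSA x hx with rfl | hcx
          · rw [if_pos hxy, if_pos rfl, abs_sub_comm]
            split_ifs <;> omega
          · have := hnb x hx hcx y hy hxy
            subst this
            rw [if_pos hxy, if_pos rfl]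
            split_ifs <;> omega
        · rw [if_neg hxy]
          split_ifs <;> omega
      have heq : ∑ u ∈ S, ∑ v ∈ S, ((if u = c then |f v - f c| else 0) +
          (if v = c then |f u - f c| else 0)) = 2 * ∑ x ∈ S, |f x - f c| := by
        simp only [Finset.sum_add_distrib]
        rw [Finset.sum_comm]
        simp only [Finset.sum_ite_eq', hc, if_true]
        ring
      have hs := hf.sum (fun i => |i - f c|)
      rw [heq, hs, hfc] at hle
      have := sum_star_le S.card
      linarith
    · have hAS : A ⊂ S := by
        refine Finset.ssubset_iff_subset_ne.mpr ⟨Finset.filter_subset _ _, fun h => ?_⟩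
        rw [h] at hcard
        exact hBe (Finset.card_eq_zero.mp (by omega))
      have hBS : B ⊂ S := by
        refine Finset.ssubset_iff_subset_ne.mpr ⟨Finset.filter_subset _ _, fun h => ?_⟩
        rw [h] at hcard
        have := Finset.card_pos.mpr ⟨c, hcA⟩
        omega
      obtain ⟨f, hf, hfc⟩ := ih A hAS
      obtain ⟨g, hg, hgc⟩ := ih B hBS
      obtain ⟨F, hF, hFc⟩ := concat G A B hAB f g hf hg 0 (by
        intro F _ _
        apply le_of_eq
        refine Finset.sum_eq_zero fun x hx => Finset.sum_eq_zero fun y hy => ?_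
        rw [if_neg]
        intro hxy
        rw [Finset.mem_filter] at hx hy
        apply hy.2
        rcases hx.2 with rfl | hcx
        · exact Or.inr hxy
        · exact Or.inl (hnb x hx.1 hcx y hy.1 hxy))
      rw [hU] at hF hFc
      refine ⟨F, hF, ?_⟩
      rw [← hcard]
      push_cast
      have : (0 : ℤ) ≤ (A.card : ℤ) * B.card := by positivity
      nlinarith

/-- A parent function of a tree rooted at `r`. -/
lemma exists_parent {n : ℕ} (t : SimpleGraph (Fin n)) (ht : t.IsTree) (r : Fin n) :
    ∃ p : Fin n → Fin n, ∀ v, v ≠ r → t.Adj v (p v) ∧ t.dist r v = t.dist r (p v) + 1 := by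
  have : ∀ v, ∃ w, v ≠ r → t.Adj v w ∧ t.dist r v = t.dist r w + 1 := by
    intro v
    by_cases hv : v = r
    · exact ⟨v, fun h => absurd hv h⟩
    obtain ⟨q, hq⟩ := ht.1.exists_walk_length_eq_dist v r
    cases q with
    | nil => exact absurd rfl hv
    | cons h q' =>
      rename_i w
      refine ⟨w, fun _ => ⟨h, ?_⟩⟩
      rw [SimpleGraph.Walk.length_cons] at hq
      have h1 := SimpleGraph.dist_le q'
      have h2 := ht.1.dist_triangle (u := v) (v := w) (w := r)
      rw [SimpleGraph.dist_eq_one_iff_adj.mpr h] at h2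
      rw [SimpleGraph.dist_comm (u := r) (v := v), SimpleGraph.dist_comm (u := r) (v := w)]
      omega
  choose p hp using this
  exact ⟨p, hp⟩

/-- The cost as a sum over non-root vertices. -/
lemma cost_eq_sum_parent {n : ℕ} (t : SimpleGraph (Fin n)) (ht : t.IsTree) (r : Fin n)
    (p : Fin n → Fin n)
    (hp : ∀ v, v ≠ r → t.Adj v (p v) ∧ t.dist r v = t.dist r (p v) + 1)
    (π : Equiv.Perm (Fin n)) :
    (cost t π : ℤ) = ∑ v ∈ Finset.univ.erase r, |((π v : ℕ) : ℤ) - ((π (p v) : ℕ) : ℤ)| := by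
  classical
  let _ := Classical.decRel t.Adj
  have hinj : Set.InjOn (fun v => s(v, p v)) (Finset.univ.erase r : Finset (Fin n)) := by
    intro v hv w hw h
    simp only [Finset.coe_erase, Finset.coe_univ, Set.mem_sdiff, Set.mem_univ,
      Set.mem_singleton_iff, true_and] at hv hw
    simp only [Sym2.eq_iff] at h
    rcases h with h | ⟨h1, h2⟩
    · exact h.1
    · have a := (hp v hv).2
      have b := (hp w hw).2
      rw [h2] at a
      rw [← h1] at b
      omega
  have himg : (Finset.univ.erase r).image (fun v => s(v, p v)) = t.edgeFinset := by
    apply Finset.eq_of_subset_of_card_le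
    · intro e he
      rw [Finset.mem_image] at he
      obtain ⟨v, hv, rfl⟩ := he
      rw [SimpleGraph.mem_edgeFinset, SimpleGraph.mem_edgeSet]
      exact (hp v (Finset.ne_of_mem_erase hv)).1
    · rw [Finset.card_image_of_injOn hinj, Finset.card_erase_of_mem (Finset.mem_univ _)]
      have := ht.card_edgeFinset
      simp only [Finset.card_univ]
      omega
  unfold cost
  rw [← himg, Finset.sum_image hinj]
  push_cast
  refine Finset.sum_congr rfl fun v _ => ?_
  simp

lemma cost_le {n : ℕ} (hn : 0 < n) (t : SimpleGraph (Fin n)) (ht : t.IsTree)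
    (π : Equiv.Perm (Fin n)) : 4 * (cost t π : ℤ) ≤ 3 * (n : ℤ) ^ 2 - 6 * n + 4 := by
  set r := π.symm ⟨0, hn⟩ with hr
  obtain ⟨p, hp⟩ := exists_parent t ht r
  rw [cost_eq_sum_parent t ht r p hp π]
  have h1 : ∑ v ∈ Finset.univ.erase r, |((π v : ℕ) : ℤ) - ((π (p v) : ℕ) : ℤ)| ≤
      ∑ v ∈ Finset.univ.erase r, max (((π v : ℕ) : ℤ)) ((n : ℤ) - 1 - ((π v : ℕ) : ℤ)) := by
    refine Finset.sum_le_sum fun v _ => ?_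
    have a := (π v).2
    have b := (π (p v)).2
    rw [abs_le]
    omega
  have h2 := Finset.add_sum_erase Finset.univ
    (fun v => max (((π v : ℕ) : ℤ)) ((n : ℤ) - 1 - ((π v : ℕ) : ℤ))) (Finset.mem_univ r)
  have h3 : ∑ v, max (((π v : ℕ) : ℤ)) ((n : ℤ) - 1 - ((π v : ℕ) : ℤ)) =
      ∑ i ∈ Finset.range n, max (i : ℤ) ((n : ℤ) - 1 - i) := by
    rw [Equiv.sum_comp π (fun i : Fin n => max ((i : ℕ) : ℤ) ((n : ℤ) - 1 - ((i : ℕ) : ℤ))),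
      Fin.sum_univ_eq_sum_range (fun i : ℕ => max (i : ℤ) ((n : ℤ) - 1 - i))]
  have h4 := sum_max_le n
  have h5 : ((π r : ℕ) : ℤ) = 0 := by simp [hr]
  simp only [h5] at h2
  have h6 : max (0 : ℤ) ((n : ℤ) - 1 - 0) = n - 1 := by omega
  linarith

lemma cost_le_costW {n : ℕ} (hn : 0 < n) (t : SimpleGraph (Fin n)) (ht : t.IsTree)
    (π : Equiv.Perm (Fin n)) :
    2 * (cost t π : ℤ) ≤ costW t Finset.univ (fun v => ((π v : ℕ) : ℤ)) := by
  classical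
  set r : Fin n := ⟨0, hn⟩
  obtain ⟨p, hp⟩ := exists_parent t ht r
  rw [cost_eq_sum_parent t ht r p hp π, two_mul]
  set F : Fin n × Fin n → ℤ := fun q => |((π q.1 : ℕ) : ℤ) - ((π q.2 : ℕ) : ℤ)| with hF
  have e1 : costW t Finset.univ (fun v => ((π v : ℕ) : ℤ)) =
      ∑ q : Fin n × Fin n with t.Adj q.1 q.2, F q := by
    rw [Finset.sum_filter, Fintype.sum_prod_type]
    rfl
  have e2 : ∑ v ∈ Finset.univ.erase r, |((π v : ℕ) : ℤ) - ((π (p v) : ℕ) : ℤ)| =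
      ∑ q ∈ (Finset.univ.erase r).image (fun v => (v, p v)), F q := by
    rw [Finset.sum_image]
    intro a _ b _ hab
    exact (Prod.ext_iff.mp hab).1
  have e3 : ∑ v ∈ Finset.univ.erase r, |((π v : ℕ) : ℤ) - ((π (p v) : ℕ) : ℤ)| =
      ∑ q ∈ (Finset.univ.erase r).image (fun v => (p v, v)), F q := by
    rw [Finset.sum_image]
    · refine Finset.sum_congr rfl fun v _ => ?_
      rw [abs_sub_comm]
    · intro a _ b _ hab
      exact (Prod.ext_iff.mp hab).2
  rw [e1]
  nth_rewrite 1 [e2]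
  rw [e3, ← Finset.sum_union]
  · apply Finset.sum_le_sum_of_subset_of_nonneg
    · intro q hq
      simp only [Finset.mem_union, Finset.mem_image, Finset.mem_erase, Finset.mem_univ,
        and_true] at hq
      simp only [Finset.mem_filter, Finset.mem_univ, true_and]
      rcases hq with ⟨v, hv, rfl⟩ | ⟨v, hv, rfl⟩
      · exact (hp v hv).1
      · exact (hp v hv).1.symm
    · intro q _ _
      exact abs_nonneg _
  · rw [Finset.disjoint_left]
    intro q h1 h2
    simp only [Finset.mem_image, Finset.mem_erase, Finset.mem_univ, and_true] at h1 h2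
    obtain ⟨v, hv, rfl⟩ := h1
    obtain ⟨w, hw, hq⟩ := h2
    rw [Prod.ext_iff] at hq
    simp only at hq
    have a := (hp v hv).2
    have b := (hp w hw).2
    rw [hq.1, hq.2] at b
    omega

lemma Dmin_le {n : ℕ} (hn : 0 < n) (t : SimpleGraph (Fin n)) (ht : t.IsTree) :
    4 * (Dmin t : ℤ) ≤ (n : ℤ) ^ 2 := by
  obtain ⟨f, hf, hfc⟩ := exists_arrangement t ht.2 Finset.univ
  simp only [Finset.card_univ, Fintype.card_fin] at hfc
  have hb : ∀ x : Fin n, 0 ≤ f x ∧ f x < n := fun x => by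
    simpa using hf.2 x (Finset.mem_univ x)
  have hinj : Function.Injective (fun x : Fin n => (⟨(f x).toNat, by
      have := hb x; omega⟩ : Fin n)) := by
    intro x y hxy
    rw [Fin.mk.injEq] at hxy
    refine hf.1 x (Finset.mem_univ x) y (Finset.mem_univ y) ?_
    have := hb x
    have := hb y
    omega
  let π : Equiv.Perm (Fin n) := Equiv.ofBijective _ (Finite.injective_iff_bijective.mp hinj)
  have hπ : (fun v => ((π v : ℕ) : ℤ)) = f := by
    funext v
    change (((f v).toNat : ℕ) : ℤ) = f v
    have := hb v
    omega
  have h1 := cost_le_costW hn t ht π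
  rw [hπ] at h1
  have h2 : Dmin t ≤ cost t π := Finset.inf'_le _ (Finset.mem_univ π)
  have h3 : (Dmin t : ℤ) ≤ cost t π := by exact_mod_cast h2
  linarith

theorem Omega_ge_neg_five (n : ℕ) (hn : 3 ≤ n) (t : SimpleGraph (Fin n))
    (ht : t.IsTree) (π : Equiv.Perm (Fin n)) :
    -5 ≤ Omega t π := by
  have h1 := cost_le (by omega) t ht π
  have h2 := Dmin_le (by omega) t ht
  have h1' : 4 * (cost t π : ℚ) ≤ 3 * (n : ℚ) ^ 2 - 6 * n + 4 := by exact_mod_cast h1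
  have h2' : 4 * (Dmin t : ℚ) ≤ (n : ℚ) ^ 2 := by exact_mod_cast h2
  have hn' : (3 : ℚ) ≤ n := by exact_mod_cast hn
  unfold Omega Drla
  rw [le_div_iff₀]
  · linarith
  · nlinarith
end

section
/- For every integer n ≥ 2 and every tree t on n vertices, the expected value of Δ under a uniformly random linear arrangement, which equals D_rla(n) − D_min(t) = (n² − 1)/3 − D_min(t), satisfies (1/12)(n² − 4 + 3(n mod 2)) ≤ D_rla(n) − D_min(t) ≤ (1/3)(n − 1)(n − 2), the lower bound being attained by the star tree and the upper bound by the linear tree (path). -/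
open Finset

/-- The star tree on `n` vertices with hub `h`: `h` is adjacent to every other
vertex and there are no other edges. -/
def starTree (n : ℕ) (h : Fin n) : SimpleGraph (Fin n) :=
  SimpleGraph.fromRel (fun u _ => u = h)


/-- Twice the cost is the sum over ordered pairs of adjacent vertices. -/
lemma two_mul_cost {n : ℕ} (t : SimpleGraph (Fin n)) (π : Equiv.Perm (Fin n))
    [DecidableRel t.Adj] :
    2 * cost t π = ∑ u, ∑ v, if t.Adj u v then
      (((π u : ℕ) : ℤ) - ((π v : ℕ) : ℤ)).natAbs else 0 := by
  classical
  unfold cost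
  rw [← Finset.sum_product', ← Finset.sum_filter, Finset.mul_sum]
  rw [← Finset.sum_fiberwise_of_maps_to (t := @SimpleGraph.edgeFinset _ t (@SimpleGraph.fintypeEdgeSet _ t _ (Classical.decRel t.Adj)))
    (g := fun p : Fin n × Fin n => s(p.1, p.2))]
  · apply Finset.sum_congr rfl
    intro e he
    induction e using Sym2.ind with
    | _ x y =>
      have hxy : t.Adj x y := by simpa using he
      have hne := hxy.ne
      have : ({p ∈ ({p ∈ (univ : Finset (Fin n)) ×ˢ univ | t.Adj p.1 p.2}) | s(p.1, p.2) = s(x, y)}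
          : Finset (Fin n × Fin n)) = {(x, y), (y, x)} := by
        ext ⟨a, b⟩
        simp only [mem_filter, mem_product, mem_univ, true_and, mem_insert, mem_singleton,
          Sym2.eq_iff, Prod.mk.injEq]
        constructor
        · rintro ⟨_, h⟩; exact h
        · rintro (⟨rfl, rfl⟩ | ⟨rfl, rfl⟩)
          · exact ⟨hxy, by simp⟩
          · exact ⟨hxy.symm, by simp⟩
      rw [this, Finset.sum_pair (by simp [hne])]
      simp only [Sym2.lift_mk]
      omega
  · rintro ⟨a, b⟩ h
    simpa using h

/-- Every finite tree has an arrangement of cost at most `⌊n²/4⌋`. -/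
lemma exists_arr (m : ℕ) : ∀ (V : Type) [Fintype V] [DecidableEq V] (G : SimpleGraph V)
    [DecidableRel G.Adj], G.IsTree → Fintype.card V = m + 1 →
    ∃ f : V → ℕ, Function.Injective f ∧ (∀ v, f v < m + 1) ∧
      ∑ u, ∑ v, (if G.Adj u v then ((f u : ℤ) - (f v : ℤ)).natAbs else 0)
        ≤ 2 * ((m + 1) ^ 2 / 4) := by
  induction m with
  | zero =>
    intro V _ _ G _ hG hc
    have : Subsingleton V := Fintype.card_le_one_iff_subsingleton.mp (by omega)
    refine ⟨fun _ => 0, fun a b _ => Subsingleton.elim a b, by simp, by simp⟩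
  | succ m ih =>
    intro V _ _ G _ hG hc
    have : Nontrivial V := Fintype.one_lt_card_iff_nontrivial.mp (by omega)
    obtain ⟨l, hl⟩ := hG.exists_vert_degree_one_of_nontrivial
    obtain ⟨w, hlw, hw⟩ := SimpleGraph.degree_eq_one_iff_existsUnique_adj.mp hl
    have hT : (G.induce {v | v ≠ l}).IsTree :=
      ⟨hG.connected.induce_compl_singleton_of_degree_eq_one hl, hG.isAcyclic.induce _⟩
    obtain ⟨f, hf, hlt, hsum⟩ := ih {v // v ≠ l} (G.induce {v | v ≠ l}) hT
      (by rw [Fintype.card_subtype_compl]; simp [hc])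
    have hwl : w ≠ l := hlw.ne'
    obtain ⟨a, s, has, hd⟩ : ∃ a s : ℕ, (a = 0 ∧ s = 1 ∨ a = m + 1 ∧ s = 0) ∧
        ((a : ℤ) - ((f ⟨w, hwl⟩ + s : ℕ) : ℤ)).natAbs ≤ (m + 2) / 2 := by
      have := hlt ⟨w, hwl⟩
      by_cases h : 2 * (f ⟨w, hwl⟩ + 1) ≤ m + 2
      · exact ⟨0, 1, by simp, by omega⟩
      · exact ⟨m + 1, 0, by simp, by omega⟩
    have hne : ∀ v : {v // v ≠ l}, f v + s ≠ a := by
      intro v; have := hlt v; omega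
    set g : V → ℕ := fun v => if h : v = l then a else f ⟨v, h⟩ + s with hg
    have gl : g l = a := by simp [hg]
    have gs : ∀ v : {v // v ≠ l}, g v.1 = f v + s := by
      intro v; simp [hg, v.2]
    refine ⟨g, ?_, ?_, ?_⟩
    · intro x y hxy
      by_cases hx : x = l <;> by_cases hy : y = l
      · rw [hx, hy]
      · rw [hx, gl, gs ⟨y, hy⟩] at hxy; exact absurd hxy.symm (hne _)
      · rw [hy, gl, gs ⟨x, hx⟩] at hxy; exact absurd hxy (hne _)
      · rw [gs ⟨x, hx⟩, gs ⟨y, hy⟩] at hxy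
        have := hf (Nat.add_right_cancel hxy)
        simpa using this
    · intro v
      by_cases hv : v = l
      · rw [hv, gl]; omega
      · rw [gs ⟨v, hv⟩]; have := hlt ⟨v, hv⟩; omega
    · have adj_iff : ∀ v, G.Adj l v ↔ v = w := fun v => ⟨fun h => hw v h, fun h => h ▸ hlw⟩
      have adj_iff' : ∀ v, G.Adj v l ↔ v = w := fun v => by rw [G.adj_comm, adj_iff]
      rw [Fintype.sum_eq_add_sum_subtype_ne _ l]
      have h1 : ∑ v, (if G.Adj l v then ((g l : ℤ) - (g v : ℤ)).natAbs else 0)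
          ≤ (m + 2) / 2 := by
        simp only [adj_iff, Finset.sum_ite_eq', Finset.mem_univ, if_true]
        rw [gl, gs ⟨w, hwl⟩]; exact hd
      have h2 : ∑ u : {v // v ≠ l}, ∑ v,
          (if G.Adj u.1 v then ((g u.1 : ℤ) - (g v : ℤ)).natAbs else 0)
          = ∑ u : {v // v ≠ l},
            (if u = ⟨w, hwl⟩ then ((g u.1 : ℤ) - (g l : ℤ)).natAbs else 0)
            + ∑ u : {v // v ≠ l}, ∑ v : {v // v ≠ l},
              (if (G.induce {v | v ≠ l}).Adj u v then
                ((f u : ℤ) - (f v : ℤ)).natAbs else 0) := by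
        rw [← Finset.sum_add_distrib]
        refine Finset.sum_congr rfl fun u _ => ?_
        rw [Fintype.sum_eq_add_sum_subtype_ne _ l]
        congr 1
        · simp only [adj_iff', Subtype.ext_iff]
        · refine Finset.sum_congr rfl fun v _ => ?_
          rw [gs, gs]
          simp only [SimpleGraph.comap_adj, Function.Embedding.subtype_apply]
          split_ifs <;> first | rfl | (congr 1; push_cast; ring)
      rw [h2]
      rw [Finset.sum_ite_eq', if_pos (Finset.mem_univ _)]
      have h3 : ((g w : ℤ) - (g l : ℤ)).natAbs ≤ (m + 2) / 2 := by
        rw [gl, gs ⟨w, hwl⟩]; omega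
      have h4 : (m + 1) ^ 2 / 4 + (m + 2) / 2 ≤ (m + 1 + 1) ^ 2 / 4 := by
        rcases Nat.even_or_odd' m with ⟨k, rfl | rfl⟩ <;> ring_nf <;> omega
      have h5 : ((g (⟨w, hwl⟩ : {v // v ≠ l}).1 : ℤ) - (g l : ℤ)).natAbs ≤ (m + 2) / 2 := h3
      omega

lemma Dmin_le_s13 {n : ℕ} (t : SimpleGraph (Fin n)) (π) : Dmin t ≤ cost t π :=
  Finset.inf'_le _ (Finset.mem_univ π)

lemma le_Dmin {n : ℕ} (t : SimpleGraph (Fin n)) (c : ℕ) (h : ∀ π, c ≤ cost t π) : c ≤ Dmin t :=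
  Finset.le_inf' _ _ fun π _ => h π

lemma tree_upper {n : ℕ} (hn : 2 ≤ n) (t : SimpleGraph (Fin n)) (ht : t.IsTree) :
    Dmin t ≤ n ^ 2 / 4 := by
  classical
  obtain ⟨m, rfl⟩ : ∃ m, n = m + 1 := ⟨n - 1, by omega⟩
  obtain ⟨f, hf, hlt, hs⟩ := exists_arr m (Fin (m + 1)) t ht (by simp)
  let π : Equiv.Perm (Fin (m + 1)) := Equiv.ofBijective (fun v => (⟨f v, hlt v⟩ : Fin (m + 1)))
    (Finite.injective_iff_bijective.mp fun a b hab => hf (by simpa using hab))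
  have h := two_mul_cost t π
  have h' : 2 * cost t π ≤ 2 * ((m + 1) ^ 2 / 4) := by rw [h]; exact hs
  have := Dmin_le_s13 t π
  omega

lemma conn_lower {n : ℕ} (t : SimpleGraph (Fin n)) (ht : t.Connected) :
    n - 1 ≤ Dmin t := by
  classical
  apply le_Dmin
  intro π
  have h1 := ht.card_vert_le_card_edgeSet_add_one
  rw [Nat.card_eq_fintype_card, Nat.card_eq_fintype_card, Fintype.card_fin] at h1
  letI := Classical.decRel t.Adj
  have h2 : #t.edgeFinset ≤ cost t π := by
    unfold cost
    rw [Finset.card_eq_sum_ones]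
    apply Finset.sum_le_sum
    intro e he
    induction e using Sym2.ind with
    | _ x y =>
      have hxy : t.Adj x y := by simpa using he
      have : (π x : ℕ) ≠ π y := fun h => hxy.ne (π.injective (Fin.ext h))
      simp only [Sym2.lift_mk]
      omega
  rw [SimpleGraph.edgeFinset_card] at h2
  have h3 : Fintype.card t.edgeSet ≤ cost t π := by convert h2
  omega

lemma path_Dmin {n : ℕ} (hn : 2 ≤ n) : Dmin (SimpleGraph.pathGraph n) = n - 1 := by
  classical
  obtain ⟨m, rfl⟩ : ∃ m, n = m + 1 := ⟨n - 1, by omega⟩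
  apply le_antisymm _ (conn_lower _ (SimpleGraph.pathGraph_connected m))
  refine (Dmin_le_s13 _ 1).trans ?_
  have h := two_mul_cost (SimpleGraph.pathGraph (m + 1)) 1
  have e : ∑ u : Fin (m + 1), ∑ v : Fin (m + 1), (if (v : ℕ) + 1 = u then 1 else 0) = m := by
    rw [Fin.sum_univ_succ]
    have : ∀ i : Fin m, ∑ v : Fin (m + 1), (if (v : ℕ) + 1 = i.succ then 1 else 0) = 1 := by
      intro i
      rw [Finset.sum_eq_single i.castSucc] <;> simp [Fin.ext_iff]
    rw [Finset.sum_congr rfl fun i _ => this i]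
    simp
  have : ∀ u v : Fin (m + 1), (if (SimpleGraph.pathGraph (m + 1)).Adj u v then
      ((((1 : Equiv.Perm (Fin (m + 1))) u : ℕ) : ℤ)
        - (((1 : Equiv.Perm (Fin (m + 1))) v : ℕ) : ℤ)).natAbs else 0)
      = (if (v : ℕ) + 1 = u then 1 else 0) + (if (u : ℕ) + 1 = v then 1 else 0) := by
    intro u v
    simp only [SimpleGraph.pathGraph_adj, Equiv.Perm.one_apply]
    split_ifs <;> omega
  simp only [this, Finset.sum_add_distrib] at h
  rw [e, Finset.sum_comm, e] at h
  omega

lemma star_cost {n : ℕ} (h : Fin n) (π : Equiv.Perm (Fin n)) :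
    cost (starTree n h) π = ∑ j : Fin n, ((j : ℤ) - ((π h : ℕ) : ℤ)).natAbs := by
  classical
  have H := two_mul_cost (starTree n h) π
  have : ∀ u v : Fin n, (if (starTree n h).Adj u v then
      (((π u : ℕ) : ℤ) - ((π v : ℕ) : ℤ)).natAbs else 0)
      = (if u = h then (((π v : ℕ) : ℤ) - ((π h : ℕ) : ℤ)).natAbs else 0)
       + (if v = h then (((π u : ℕ) : ℤ) - ((π h : ℕ) : ℤ)).natAbs else 0) := by
    intro u v
    simp only [starTree, SimpleGraph.fromRel_adj]
    by_cases hu : u = h <;> by_cases hv : v = h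
    · simp [hu, hv]
    · subst hu; simp [hv, Ne.symm hv]; omega
    · subst hv; simp [hu]
    · simp [hu, hv]
  simp only [this, Finset.sum_add_distrib] at H
  rw [Finset.sum_comm] at H
  simp only [Finset.sum_ite_eq', Finset.mem_univ, if_true] at H
  rw [Equiv.sum_comp π (fun j : Fin n => ((j : ℤ) - ((π h : ℕ) : ℤ)).natAbs)] at H
  omega

lemma sum_dist (p q : ℕ) :
    2 * ∑ j ∈ Finset.range (p + 1 + q), ((j : ℤ) - (p : ℤ)).natAbs
      = p * (p + 1) + q * (q + 1) := by
  induction q with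
  | zero =>
    rw [add_zero, ← Finset.sum_range_reflect]
    have : ∀ j ∈ Finset.range (p + 1), (((p + 1 - 1 - j : ℕ) : ℤ) - (p : ℤ)).natAbs = j := by
      intro j hj; have := Finset.mem_range.mp hj; omega
    rw [Finset.sum_congr rfl this, mul_comm, Finset.sum_range_id_mul_two]
    simp [mul_comm]
  | succ q ih =>
    rw [← add_assoc, Finset.sum_range_succ, mul_add, ih]
    have : (((p + 1 + q : ℕ) : ℤ) - (p : ℤ)).natAbs = q + 1 := by omega
    rw [this]; ring

lemma star_cost' {n : ℕ} (h : Fin n) (π : Equiv.Perm (Fin n)) (p q : ℕ) (hp : (π h : ℕ) = p)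
    (hq : p + 1 + q = n) :
    2 * cost (starTree n h) π = p * (p + 1) + q * (q + 1) := by
  rw [star_cost, hp, Fin.sum_univ_eq_sum_range (fun j => ((j : ℤ) - (p : ℤ)).natAbs) n, ← hq,
    sum_dist]

lemma star_Dmin {n : ℕ} (hn : 2 ≤ n) (h : Fin n) : Dmin (starTree n h) = n ^ 2 / 4 := by
  apply le_antisymm
  · have H := star_cost' h (Equiv.swap h ⟨n / 2, by omega⟩) (n / 2) (n - 1 - n / 2)
      (by simp) (by omega)
    refine (Dmin_le_s13 _ (Equiv.swap h ⟨n / 2, by omega⟩)).trans ?_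
    have : (n / 2) * (n / 2 + 1) + (n - 1 - n / 2) * (n - 1 - n / 2 + 1) ≤ 2 * (n ^ 2 / 4) := by
      rcases Nat.even_or_odd' n with ⟨k, hk | hk⟩
      · obtain ⟨j, rfl⟩ : ∃ j, k = j + 1 := ⟨k - 1, by omega⟩
        rw [show n / 2 = j + 1 by omega, show n - 1 - (j + 1) = j by omega, hk]
        ring_nf; omega
      · rw [show n / 2 = k by omega, show n - 1 - k = k by omega, hk]
        ring_nf; omega
    omega
  · apply le_Dmin
    intro π
    obtain ⟨q, hq⟩ : ∃ q, (π h : ℕ) + 1 + q = n := ⟨n - 1 - π h, by have := (π h).2; omega⟩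
    have H := star_cost' h π _ q rfl hq
    generalize (π h : ℕ) = p at *
    have : n ^ 2 ≤ 4 * cost (starTree n h) π + 1 := by
      zify at *
      nlinarith [sq_nonneg ((p : ℤ) - q)]
    omega

theorem expected_Delta_bounds (n : ℕ) (hn : 2 ≤ n) (t : SimpleGraph (Fin n))
    (ht : t.IsTree) :
    (1 / 12) * ((n : ℚ) ^ 2 - 4 + 3 * ((n % 2 : ℕ) : ℚ))
        ≤ Drla n - (Dmin t : ℚ) ∧
    Drla n - (Dmin t : ℚ) ≤ (1 / 3) * ((n : ℚ) - 1) * ((n : ℚ) - 2) ∧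
    (∀ h : Fin n, Drla n - (Dmin (starTree n h) : ℚ)
        = (1 / 12) * ((n : ℚ) ^ 2 - 4 + 3 * ((n % 2 : ℕ) : ℚ))) ∧
    Drla n - (Dmin (SimpleGraph.pathGraph n) : ℚ)
        = (1 / 3) * ((n : ℚ) - 1) * ((n : ℚ) - 2) := by
  have key : 4 * (((n ^ 2 / 4 : ℕ)) : ℚ) = (n : ℚ) ^ 2 - ((n % 2 : ℕ) : ℚ) := by
    have : 4 * (n ^ 2 / 4) + n % 2 = n ^ 2 := by
      rcases Nat.even_or_odd' n with ⟨k, rfl | rfl⟩ <;> ring_nf <;> omega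
    have : (4 * ((n ^ 2 / 4 : ℕ) : ℚ)) + ((n % 2 : ℕ) : ℚ) = (n : ℚ) ^ 2 := by exact_mod_cast this
    linarith
  have hm : (((n - 1 : ℕ)) : ℚ) = (n : ℚ) - 1 := by
    rw [Nat.cast_sub (by omega)]; simp
  unfold Drla
  refine ⟨?_, ?_, ?_, ?_⟩
  · have : (Dmin t : ℚ) ≤ ((n ^ 2 / 4 : ℕ) : ℚ) := by exact_mod_cast tree_upper hn t ht
    linarith
  · have : ((n - 1 : ℕ) : ℚ) ≤ (Dmin t : ℚ) := by exact_mod_cast conn_lower t ht.connected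
    rw [hm] at this
    linarith
  · intro h
    rw [star_Dmin hn h]
    linarith
  · rw [path_Dmin hn, hm]
    ring
end
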